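/- (Theorem 6, sparsity bound for square-root lasso.) Let c > 1 and c̄ = (c+1)/(c−1), let β̂ be any square-root lasso minimizer, T̂ = {j : β̂ⱼ ≠ 0}, and m̂ = |T̂ \ T|. Suppose λ/n ≥ c‖Γ⁻¹S̃‖_∞, κ̃ > 0, ρ̄ := λ√s/(nκ̃) < 1/√2, and 2ϱ_c̄(ϱ_c̄ + ρ̄)/(1 − ρ̄²) ≤ 1/c̄. Then |T̂| ≤ 4c̄²·((n/λ)·(ϱ_c̄ + ρ̄)/(1 − ρ̄²))²·φ_max(m̂, Γ⁻¹E_n[x_ix_i']Γ⁻¹). Moreover, if κ_c̄ > 0, then m̂ ≤ s·(4c̄²/κ_c̄)²·min_{m∈M} φ_max(m, Γ⁻¹E_n[x_ix_i']Γ⁻¹), where M = {m ∈ ℕ : m > s·φ_max(m, Γ⁻¹E_n[x_ix_i']Γ⁻¹)·2·(4c̄²/κ_c̄)²}, provided M is nonempty. -/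

import Mathlib

open Finset MeasureTheory ProbabilityTheory

namespace SqrtLasso

/-- Empirical average `E_n[h_i] = n⁻¹ ∑ᵢ h i`. -/
noncomputable def En (n : ℕ) (h : Fin n → ℝ) : ℝ := (∑ i, h i) / n

/-- Euclidean inner product `a'b = ∑ⱼ aⱼ bⱼ`. -/
noncomputable def dot {p : ℕ} (a b : Fin p → ℝ) : ℝ := ∑ j, a j * b j

/-- Prediction norm `‖δ‖_{2,n} = (E_n[(x_i'δ)²])^{1/2}`. -/
noncomputable def predNorm (n : ℕ) {p : ℕ} (x : Fin n → Fin p → ℝ) (δ : Fin p → ℝ) : ℝ :=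
  Real.sqrt (En n fun i => (dot (x i) δ) ^ 2)

/-- `ℓ₁` norm of a vector. -/
noncomputable def l1 {p : ℕ} (v : Fin p → ℝ) : ℝ := ∑ j, |v j|

/-- Restriction `v_S`: equal to `v` on `S` and `0` outside. -/
def restr {p : ℕ} (S : Finset (Fin p)) (v : Fin p → ℝ) : Fin p → ℝ :=
  fun j => if j ∈ S then v j else 0

/-- `Γ v`, i.e. componentwise rescaling by loadings `γ`. -/
noncomputable def scl {p : ℕ} (γ v : Fin p → ℝ) : Fin p → ℝ := fun j => γ j * v j

/-- The support of a vector. -/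
noncomputable def supp {p : ℕ} (β : Fin p → ℝ) : Finset (Fin p) := Finset.univ.filter fun j => β j ≠ 0

/-- The least-squares criterion `Q̂(β) = E_n[(y_i - x_i'β)²]`. -/
noncomputable def Qhat (n : ℕ) {p : ℕ} (x : Fin n → Fin p → ℝ) (y : Fin n → ℝ)
    (β : Fin p → ℝ) : ℝ := En n fun i => (y i - dot (x i) β) ^ 2

/-- The restricted set `Δ_c̄`. -/
def Delta {p : ℕ} (γ : Fin p → ℝ) (T : Finset (Fin p)) (cb : ℝ) : Set (Fin p → ℝ) :=
  {δ | δ ≠ 0 ∧ l1 (scl γ (restr Tᶜ δ)) ≤ cb * l1 (scl γ (restr T δ))}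

/-- The restricted eigenvalue `κ_c̄`. -/
noncomputable def kappa (n : ℕ) {p : ℕ} (x : Fin n → Fin p → ℝ) (γ : Fin p → ℝ)
    (T : Finset (Fin p)) (cb : ℝ) : ℝ :=
  sInf {r | ∃ δ ∈ Delta γ T cb,
    r = Real.sqrt T.card * predNorm n x δ / l1 (scl γ (restr T δ))}

/-- The quantity `κ̃`. -/
noncomputable def kappaTilde (n : ℕ) {p : ℕ} (x : Fin n → Fin p → ℝ) (γ : Fin p → ℝ)
    (T : Finset (Fin p)) : ℝ :=
  sInf {r | ∃ δ : Fin p → ℝ, l1 (scl γ (restr Tᶜ δ)) < l1 (scl γ (restr T δ)) ∧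
    r = Real.sqrt T.card * predNorm n x δ /
      (l1 (scl γ (restr T δ)) - l1 (scl γ (restr Tᶜ δ)))}

/-- The score `S̃ = E_n[x_i(σε_i + r_i)] / √(E_n[(σε_i + r_i)²])`. -/
noncomputable def score (n : ℕ) {p : ℕ} (x : Fin n → Fin p → ℝ) (ε rr : Fin n → ℝ)
    (σ : ℝ) : Fin p → ℝ :=
  fun j => En n (fun i => x i j * (σ * ε i + rr i)) /
    Real.sqrt (En n fun i => (σ * ε i + rr i) ^ 2)

/-- `‖Γ⁻¹ S̃‖_∞ = max_j |S̃_j| / γ_j`. -/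
noncomputable def scoreSup (n : ℕ) {p : ℕ} (x : Fin n → Fin p → ℝ) (ε rr : Fin n → ℝ)
    (σ : ℝ) (γ : Fin p → ℝ) : ℝ :=
  ⨆ j, |score n x ε rr σ j| / γ j

/-- The quantity `ϱ_c̄`. -/
noncomputable def varrho (n : ℕ) {p : ℕ} (x : Fin n → Fin p → ℝ) (γ : Fin p → ℝ)
    (T : Finset (Fin p)) (β₀ : Fin p → ℝ) (S : Fin p → ℝ) (cb : ℝ) : ℝ :=
  sSup {r | ∃ δ ∈ Delta γ T cb, 0 < predNorm n x δ ∧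
    l1 (scl γ (δ + β₀)) ≤ cb * l1 (scl γ β₀) ∧ r = |dot S δ| / predNorm n x δ}

/-- Quadratic form `δ'Mδ`. -/
noncomputable def quadForm {p : ℕ} (M : Fin p → Fin p → ℝ) (δ : Fin p → ℝ) : ℝ :=
  ∑ j, ∑ k, δ j * M j k * δ k

/-- Maximal `m`-sparse eigenvalue `φ_max(m, M)`. -/
noncomputable def phiMax {p : ℕ} (M : Fin p → Fin p → ℝ) (T : Finset (Fin p)) (m : ℕ) : ℝ :=
  sSup {r | ∃ δ : Fin p → ℝ, δ ≠ 0 ∧ (supp δ \ T).card ≤ m ∧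
    r = quadForm M δ / ∑ j, (δ j) ^ 2}

/-- Minimal `m`-sparse eigenvalue `φ_min(m, M)`. -/
noncomputable def phiMin {p : ℕ} (M : Fin p → Fin p → ℝ) (T : Finset (Fin p)) (m : ℕ) : ℝ :=
  sInf {r | ∃ δ : Fin p → ℝ, δ ≠ 0 ∧ (supp δ \ T).card ≤ m ∧
    r = quadForm M δ / ∑ j, (δ j) ^ 2}

/-- Gram matrix `E_n[x_i x_i']`. -/
noncomputable def gram (n : ℕ) {p : ℕ} (x : Fin n → Fin p → ℝ) : Fin p → Fin p → ℝ :=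
  fun j k => En n fun i => x i j * x i k

/-- Rescaled Gram matrix `Γ⁻¹ E_n[x_i x_i'] Γ⁻¹`. -/
noncomputable def rgram (n : ℕ) {p : ℕ} (x : Fin n → Fin p → ℝ) (γ : Fin p → ℝ) :
    Fin p → Fin p → ℝ :=
  fun j k => gram n x j k / (γ j * γ k)


lemma En_add (n : ℕ) (f g : Fin n → ℝ) : En n (fun i => f i + g i) = En n f + En n g := by
  simp only [En, Finset.sum_add_distrib, add_div]

lemma En_smul (n : ℕ) (a : ℝ) (f : Fin n → ℝ) : En n (fun i => a * f i) = a * En n f := by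
  simp only [En, ← Finset.mul_sum, mul_div_assoc]

lemma En_nonneg (n : ℕ) (f : Fin n → ℝ) (h : ∀ i, 0 ≤ f i) : 0 ≤ En n f :=
  div_nonneg (Finset.sum_nonneg fun i _ => h i) (Nat.cast_nonneg n)

lemma En_cs (n : ℕ) (f g : Fin n → ℝ) :
    (En n fun i => f i * g i) ^ 2 ≤ (En n fun i => f i ^ 2) * (En n fun i => g i ^ 2) := by
  simp only [En]
  rw [div_pow, div_mul_div_comm, ← sq]
  exact div_le_div_of_nonneg_right (Finset.sum_mul_sq_le_sq_mul_sq _ f g) (by positivity)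

lemma En_sum (n : ℕ) {p : ℕ} (f : Fin p → Fin n → ℝ) :
    En n (fun i => ∑ j, f j i) = ∑ j, En n (f j) := by
  simp only [En]
  rw [Finset.sum_comm, Finset.sum_div]

lemma dot_add {p : ℕ} (a b d : Fin p → ℝ) : dot a (b + d) = dot a b + dot a d := by
  simp [dot, mul_add, Finset.sum_add_distrib]

lemma dot_sub {p : ℕ} (a b d : Fin p → ℝ) : dot a (b - d) = dot a b - dot a d := by
  simp [dot, mul_sub, Finset.sum_sub_distrib]

lemma dot_smul {p : ℕ} (a b : Fin p → ℝ) (t : ℝ) : dot a (t • b) = t * dot a b := by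
  simp only [dot, Finset.mul_sum, Pi.smul_apply, smul_eq_mul]
  exact Finset.sum_congr rfl fun j _ => by ring

lemma l1_nonneg {p : ℕ} (v : Fin p → ℝ) : 0 ≤ l1 v := Finset.sum_nonneg fun _ _ => abs_nonneg _

lemma predNorm_sq (n : ℕ) {p : ℕ} (x : Fin n → Fin p → ℝ) (d : Fin p → ℝ) :
    predNorm n x d ^ 2 = En n fun i => (dot (x i) d) ^ 2 :=
  Real.sq_sqrt (En_nonneg _ _ fun _ => sq_nonneg _)

lemma l1_split {p : ℕ} (γ v : Fin p → ℝ) (T : Finset (Fin p)) :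
    l1 (scl γ v) = l1 (scl γ (restr T v)) + l1 (scl γ (restr Tᶜ v)) := by
  simp only [l1, scl, restr, ← Finset.sum_add_distrib]
  refine Finset.sum_congr rfl fun j _ => ?_
  by_cases h : j ∈ T <;> simp [h]

lemma l1_add_le {p : ℕ} (γ v w : Fin p → ℝ) :
    l1 (scl γ (v + w)) ≤ l1 (scl γ v) + l1 (scl γ w) := by
  simp only [l1, scl, ← Finset.sum_add_distrib]
  refine Finset.sum_le_sum fun j _ => ?_
  simp only [Pi.add_apply, mul_add]
  exact abs_add_le _ _

lemma l1_smul {p : ℕ} (γ v : Fin p → ℝ) (t : ℝ) (ht : 0 ≤ t) :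
    l1 (scl γ (t • v)) = t * l1 (scl γ v) := by
  simp only [l1, scl, Finset.mul_sum]
  refine Finset.sum_congr rfl fun j _ => ?_
  simp only [Pi.smul_apply, smul_eq_mul]
  rw [show γ j * (t * v j) = t * (γ j * v j) by ring, abs_mul, abs_of_nonneg ht]

/-- `‖Γδ_{T^c}‖ - ‖Γδ_T‖ ≤ ‖Γβ̂‖ - ‖Γβ₀‖`. -/
lemma l1_diff {p : ℕ} (γ b b0 : Fin p → ℝ) :
    l1 (scl γ (restr (supp b0)ᶜ (b - b0))) - l1 (scl γ (restr (supp b0) (b - b0)))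
      ≤ l1 (scl γ b) - l1 (scl γ b0) := by
  simp only [l1, scl, restr, ← Finset.sum_sub_distrib]
  refine Finset.sum_le_sum fun j _ => ?_
  by_cases h : b0 j = 0
  · simp [supp, h]
  · simp only [supp, Finset.mem_compl, Finset.mem_filter, Finset.mem_univ, true_and, ne_eq, h,
      not_false_eq_true, not_true, if_true, if_false, mul_zero, abs_zero, Pi.sub_apply]
    have := abs_sub_abs_le_abs_sub (γ j * b0 j) (γ j * b j)
    rw [abs_sub_comm, ← mul_sub] at this
    linarith

lemma dot_score (n : ℕ) {p : ℕ} (x : Fin n → Fin p → ℝ) (ε rr : Fin n → ℝ) (σ : ℝ)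
    (d : Fin p → ℝ) :
    dot (score n x ε rr σ) d = (En n fun i => (σ * ε i + rr i) * dot (x i) d) /
      Real.sqrt (En n fun i => (σ * ε i + rr i) ^ 2) := by
  simp only [dot, score, div_mul_eq_mul_div, ← Finset.sum_div]
  congr 1
  simp only [Finset.mul_sum]
  rw [En_sum]
  refine Finset.sum_congr rfl fun j _ => ?_
  rw [mul_comm, ← En_smul]
  congr 1; funext i; ring

lemma score_cs (n : ℕ) {p : ℕ} (x : Fin n → Fin p → ℝ) (ε rr : Fin n → ℝ) (σ : ℝ)
    (hQ : 0 < En n fun i => (σ * ε i + rr i) ^ 2) (d : Fin p → ℝ) :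
    |dot (score n x ε rr σ) d| ≤ predNorm n x d := by
  rw [dot_score, abs_div, abs_of_nonneg (Real.sqrt_nonneg _), div_le_iff₀ (Real.sqrt_pos.2 hQ)]
  rw [predNorm, ← Real.sqrt_mul (En_nonneg _ _ fun _ => sq_nonneg _)]
  apply Real.abs_le_sqrt
  rw [mul_comm]
  exact En_cs _ _ _

/-- score bounded by dual norm -/
lemma score_dual (n : ℕ) {p : ℕ} (x : Fin n → Fin p → ℝ) (ε rr : Fin n → ℝ) (σ : ℝ)
    (γ : Fin p → ℝ) (hγ : ∀ j, 1 ≤ γ j) (j : Fin p) :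
    |score n x ε rr σ j| ≤ scoreSup n x ε rr σ γ * γ j := by
  rw [← div_le_iff₀ (by linarith [hγ j])]
  exact le_ciSup (f := fun j => |score n x ε rr σ j| / γ j) (Set.finite_range _).bddAbove j

lemma score_l1 (n : ℕ) {p : ℕ} (x : Fin n → Fin p → ℝ) (ε rr : Fin n → ℝ) (σ : ℝ)
    (γ : Fin p → ℝ) (hγ : ∀ j, 1 ≤ γ j) (d : Fin p → ℝ) :
    |dot (score n x ε rr σ) d| ≤ scoreSup n x ε rr σ γ * l1 (scl γ d) := by
  simp only [dot, l1, scl, Finset.mul_sum]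
  refine (Finset.abs_sum_le_sum_abs _ _).trans (Finset.sum_le_sum fun j _ => ?_)
  rw [abs_mul, abs_mul, abs_of_nonneg (by linarith [hγ j] : (0:ℝ) ≤ γ j), ← mul_assoc]
  exact mul_le_mul_of_nonneg_right (score_dual n x ε rr σ γ hγ j) (abs_nonneg _)

lemma le_of_forall_small (A G P : ℝ) (hP : 0 ≤ P)
    (h : ∀ t : ℝ, 0 < t → t ≤ 1 → A ≤ G + t * P) : A ≤ G := by
  by_contra hlt
  push Not at hlt
  have hpos : 0 < (A - G) / (2 * (P + 1)) := div_pos (by linarith) (by linarith)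
  have h1 := h (min 1 ((A - G) / (2 * (P + 1)))) (lt_min one_pos hpos) (min_le_left _ _)
  have h2 : min 1 ((A - G) / (2 * (P + 1))) * P ≤ (A - G) / (2 * (P + 1)) * P :=
    mul_le_mul_of_nonneg_right (min_le_right _ _) hP
  have h3 : (A - G) / (2 * (P + 1)) * (2 * (P + 1)) = A - G :=
    div_mul_cancel₀ _ (by linarith)
  nlinarith

lemma kkt (n : ℕ) {p : ℕ} (x : Fin n → Fin p → ℝ) (y : Fin n → ℝ) (γ βh : Fin p → ℝ)
    (ell : ℝ) (hell : 0 ≤ ell)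
    (hmin : ∀ β : Fin p → ℝ,
      Real.sqrt (Qhat n x y βh) + ell * l1 (scl γ βh) ≤
        Real.sqrt (Qhat n x y β) + ell * l1 (scl γ β)) (d : Fin p → ℝ) :
    Real.sqrt (Qhat n x y βh) * ell * (l1 (scl γ βh) - l1 (scl γ (βh - d))) ≤
      En n fun i => (y i - dot (x i) βh) * dot (x i) d := by
  have hQn : ∀ b, 0 ≤ Qhat n x y b := fun b => En_nonneg _ _ fun _ => sq_nonneg _
  set q := Real.sqrt (Qhat n x y βh) with hq
  have hq0 : 0 ≤ q := Real.sqrt_nonneg _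
  have hqq : q ^ 2 = Qhat n x y βh := Real.sq_sqrt (hQn _)
  apply le_of_forall_small _ _ ((En n fun i => (dot (x i) d) ^ 2) / 2)
    (div_nonneg (En_nonneg _ _ fun _ => sq_nonneg _) (by norm_num))
  intro t ht ht1
  have h := hmin (βh - t • d)
  have hc : l1 (scl γ (βh - t • d)) ≤ (1 - t) * l1 (scl γ βh) + t * l1 (scl γ (βh - d)) := by
    rw [← l1_smul γ _ (1 - t) (by linarith), ← l1_smul γ _ t ht.le]
    have : βh - t • d = (1 - t) • βh + t • (βh - d) := by
      ext j; simp; ring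
    rw [this]
    exact l1_add_le _ _ _
  have hQt : Qhat n x y (βh - t • d) = q ^ 2 +
      (2 * t) * (En n fun i => (y i - dot (x i) βh) * dot (x i) d) +
      t ^ 2 * (En n fun i => (dot (x i) d) ^ 2) := by
    rw [hqq, Qhat, Qhat, ← En_smul, ← En_smul, ← En_add, ← En_add]
    congr 1; funext i
    rw [dot_sub, dot_smul]; ring
  have hr : Real.sqrt (Qhat n x y (βh - t • d)) ^ 2 = Qhat n x y (βh - t • d) :=
    Real.sq_sqrt (hQn _)
  set R := Real.sqrt (Qhat n x y (βh - t • d)) with hR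
  set G := En n fun i => (y i - dot (x i) βh) * dot (x i) d
  set P := En n fun i => (dot (x i) d) ^ 2
  set L := l1 (scl γ βh)
  set L' := l1 (scl γ (βh - d))
  have h1 : ell * l1 (scl γ (βh - t • d)) ≤ ell * ((1 - t) * L + t * L') :=
    mul_le_mul_of_nonneg_left hc hell
  have h2 : q + t * (ell * (L - L')) ≤ R := by nlinarith
  have h3 : q * (q + t * (ell * (L - L'))) ≤ q * R := mul_le_mul_of_nonneg_left h2 hq0
  have h4 : t * (q * ell * (L - L')) ≤ t * (G + t * (P / 2)) := by
    nlinarith [sq_nonneg (q - R)]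
  exact le_of_mul_le_mul_left h4 ht

lemma varrho_bound (n : ℕ) {p : ℕ} (x : Fin n → Fin p → ℝ) (ε rr : Fin n → ℝ) (σ : ℝ)
    (hQ : 0 < En n fun i => (σ * ε i + rr i) ^ 2) (γ β₀ : Fin p → ℝ) (T : Finset (Fin p))
    (cb : ℝ) (d : Fin p → ℝ)
    (h1 : l1 (scl γ (restr Tᶜ d)) ≤ cb * l1 (scl γ (restr T d)))
    (h2 : l1 (scl γ (d + β₀)) ≤ cb * l1 (scl γ β₀)) :
    |dot (score n x ε rr σ) d| ≤ varrho n x γ T β₀ (score n x ε rr σ) cb * predNorm n x d := by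
  have hcs := score_cs n x ε rr σ hQ d
  have hD : 0 ≤ predNorm n x d := Real.sqrt_nonneg _
  rcases hD.eq_or_lt with h0 | h0
  · rw [← h0] at hcs ⊢
    simpa using hcs
  · rw [← div_le_iff₀ h0]
    apply le_csSup
    · refine ⟨1, ?_⟩
      rintro r ⟨e, -, he, -, rfl⟩
      rw [div_le_one he]
      exact score_cs n x ε rr σ hQ e
    · refine ⟨d, ⟨?_, h1⟩, h0, h2, rfl⟩
      rintro rfl
      simp [predNorm, dot, En] at h0

lemma varrho_nonneg (n : ℕ) {p : ℕ} (x : Fin n → Fin p → ℝ) (γ β₀ S : Fin p → ℝ)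
    (T : Finset (Fin p)) (cb : ℝ) : 0 ≤ varrho n x γ T β₀ S cb := by
  apply Real.sSup_nonneg
  rintro r ⟨e, -, he, -, rfl⟩
  positivity

lemma kappaTilde_bound (n : ℕ) {p : ℕ} (x : Fin n → Fin p → ℝ) (γ : Fin p → ℝ)
    (T : Finset (Fin p)) (hκ : 0 < kappaTilde n x γ T) (d : Fin p → ℝ) :
    l1 (scl γ (restr T d)) - l1 (scl γ (restr Tᶜ d)) ≤
      Real.sqrt T.card / kappaTilde n x γ T * predNorm n x d := by
  have hD : 0 ≤ predNorm n x d := Real.sqrt_nonneg _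
  rcases le_or_gt (l1 (scl γ (restr T d)) - l1 (scl γ (restr Tᶜ d))) 0 with h | h
  · exact h.trans (by positivity)
  · rw [div_mul_eq_mul_div, le_div_iff₀ hκ, mul_comm, ← le_div_iff₀ h]
    apply csInf_le
    · refine ⟨0, ?_⟩
      rintro r ⟨e, he, rfl⟩
      exact div_nonneg (mul_nonneg (Real.sqrt_nonneg _) (Real.sqrt_nonneg _)) (by linarith)
    · exact ⟨d, by linarith, rfl⟩

lemma kappa_bddBelow (n : ℕ) {p : ℕ} (x : Fin n → Fin p → ℝ) (γ : Fin p → ℝ)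
    (T : Finset (Fin p)) (cb : ℝ) : BddBelow {r | ∃ δ ∈ Delta γ T cb,
    r = Real.sqrt T.card * predNorm n x δ / l1 (scl γ (restr T δ))} := by
  refine ⟨0, ?_⟩
  rintro r ⟨e, he, rfl⟩
  exact div_nonneg (mul_nonneg (Real.sqrt_nonneg _) (Real.sqrt_nonneg _)) (l1_nonneg _)

lemma kappa_bound (n : ℕ) {p : ℕ} (x : Fin n → Fin p → ℝ) (γ : Fin p → ℝ)
    (T : Finset (Fin p)) (cb : ℝ) (hκ : 0 < kappa n x γ T cb) (d : Fin p → ℝ)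
    (hd : d ∈ Delta γ T cb) :
    l1 (scl γ (restr T d)) ≤ Real.sqrt T.card / kappa n x γ T cb * predNorm n x d := by
  have hD : 0 ≤ predNorm n x d := Real.sqrt_nonneg _
  rcases (l1_nonneg (scl γ (restr T d))).eq_or_lt with h | h
  · rw [← h]; positivity
  · rw [div_mul_eq_mul_div, le_div_iff₀ hκ, mul_comm, ← le_div_iff₀ h]
    exact csInf_le (kappa_bddBelow n x γ T cb) ⟨d, hd, rfl⟩

lemma kappa_le_tilde (n : ℕ) {p : ℕ} (x : Fin n → Fin p → ℝ) (γ : Fin p → ℝ)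
    (T : Finset (Fin p)) (cb : ℝ) (hcb : 1 ≤ cb) (hκ : 0 < kappaTilde n x γ T) :
    kappa n x γ T cb ≤ kappaTilde n x γ T := by
  apply le_csInf
  · by_contra hne
    rw [Set.not_nonempty_iff_eq_empty] at hne
    rw [kappaTilde, hne, Real.sInf_empty] at hκ
    exact lt_irrefl _ hκ
  · rintro r ⟨d, hd, rfl⟩
    have h0 := l1_nonneg (scl γ (restr Tᶜ d))
    have hmem : d ∈ Delta γ T cb := by
      refine ⟨?_, by nlinarith⟩
      rintro rfl
      simp [l1, scl, restr] at hd
    refine (csInf_le (kappa_bddBelow n x γ T cb) ⟨d, hmem, rfl⟩).trans ?_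
    apply div_le_div_of_nonneg_left
    · exact mul_nonneg (Real.sqrt_nonneg _) (Real.sqrt_nonneg _)
    · linarith
    · linarith

/-- the quadratic form of the rescaled Gram matrix -/
lemma quadForm_rgram (n : ℕ) {p : ℕ} (x : Fin n → Fin p → ℝ) (γ d : Fin p → ℝ) :
    quadForm (rgram n x γ) d = En n fun i => (dot (x i) (fun j => d j / γ j)) ^ 2 := by
  simp only [quadForm, rgram, gram, dot, sq, Finset.sum_mul_sum]
  rw [En_sum]
  refine Finset.sum_congr rfl fun j _ => ?_
  rw [En_sum]
  refine Finset.sum_congr rfl fun k _ => ?_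
  rw [show d j * ((En n fun i => x i j * x i k) / (γ j * γ k)) * d k =
    (d j / γ j * (d k / γ k)) * (En n fun i => x i j * x i k) by
      rw [div_mul_div_comm]; ring, ← En_smul]
  congr 1; funext i; ring

lemma quadForm_nonneg (n : ℕ) {p : ℕ} (x : Fin n → Fin p → ℝ) (γ d : Fin p → ℝ) :
    0 ≤ quadForm (rgram n x γ) d := by
  rw [quadForm_rgram]; exact En_nonneg _ _ fun _ => sq_nonneg _

lemma phiMax_nonneg (n : ℕ) {p : ℕ} (x : Fin n → Fin p → ℝ) (γ : Fin p → ℝ)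
    (T : Finset (Fin p)) (m : ℕ) : 0 ≤ phiMax (rgram n x γ) T m := by
  apply Real.sSup_nonneg
  rintro r ⟨d, -, -, rfl⟩
  exact div_nonneg (quadForm_nonneg _ _ _ _) (Finset.sum_nonneg fun _ _ => sq_nonneg _)

lemma sumsq_pos {p : ℕ} {d : Fin p → ℝ} (h : d ≠ 0) : 0 < ∑ j, d j ^ 2 := by
  obtain ⟨j, hj⟩ := Function.ne_iff.1 h
  exact Finset.sum_pos' (fun _ _ => sq_nonneg _) ⟨j, Finset.mem_univ _, by
    have : d j ≠ 0 := hj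
    positivity⟩

lemma phiMax_bdd {p : ℕ} (M : Fin p → Fin p → ℝ) (T : Finset (Fin p)) (m : ℕ) :
    BddAbove {r | ∃ δ : Fin p → ℝ, δ ≠ 0 ∧ (supp δ \ T).card ≤ m ∧
    r = quadForm M δ / ∑ j, (δ j) ^ 2} := by
  refine ⟨∑ j, ∑ k, |M j k|, ?_⟩
  rintro r ⟨d, hd, -, rfl⟩
  rw [div_le_iff₀ (sumsq_pos hd), quadForm, Finset.sum_mul]
  refine Finset.sum_le_sum fun j _ => ?_
  rw [Finset.sum_mul]
  refine Finset.sum_le_sum fun k _ => ?_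
  have hj : d j ^ 2 ≤ ∑ j, d j ^ 2 :=
    Finset.single_le_sum (f := fun j => d j ^ 2) (fun _ _ => sq_nonneg _) (Finset.mem_univ j)
  have hk : d k ^ 2 ≤ ∑ j, d j ^ 2 :=
    Finset.single_le_sum (f := fun j => d j ^ 2) (fun _ _ => sq_nonneg _) (Finset.mem_univ k)
  calc d j * M j k * d k ≤ |d j * M j k * d k| := le_abs_self _
    _ = |M j k| * (|d j| * |d k|) := by rw [abs_mul, abs_mul]; ring
    _ ≤ _ := by
      apply mul_le_mul_of_nonneg_left _ (abs_nonneg _)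
      nlinarith [sq_nonneg (|d j| - |d k|), sq_abs (d j), sq_abs (d k)]

lemma phiMax_bound (n : ℕ) {p : ℕ} (x : Fin n → Fin p → ℝ) (γ : Fin p → ℝ)
    (T : Finset (Fin p)) (m : ℕ) (d : Fin p → ℝ) (hd : (supp d \ T).card ≤ m) :
    quadForm (rgram n x γ) d ≤ phiMax (rgram n x γ) T m * ∑ j, d j ^ 2 := by
  by_cases h : d = 0
  · subst h; simp [quadForm]
  · rw [← div_le_iff₀ (sumsq_pos h)]
    exact le_csSup (phiMax_bdd _ _ _) ⟨d, h, hd, rfl⟩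

lemma phiMax_le (n : ℕ) {p : ℕ} (x : Fin n → Fin p → ℝ) (γ : Fin p → ℝ)
    (T : Finset (Fin p)) (m : ℕ) (B : ℝ) (hB : 0 ≤ B)
    (h : ∀ d : Fin p → ℝ, (supp d \ T).card ≤ m →
      quadForm (rgram n x γ) d ≤ B * ∑ j, d j ^ 2) :
    phiMax (rgram n x γ) T m ≤ B := by
  apply Real.sSup_le _ hB
  rintro r ⟨d, hd, hm, rfl⟩
  rw [div_le_iff₀ (sumsq_pos hd)]
  exact h d hm

lemma phiMax_mono (n : ℕ) {p : ℕ} (x : Fin n → Fin p → ℝ) (γ : Fin p → ℝ)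
    (T : Finset (Fin p)) {m k : ℕ} (hmk : m ≤ k) :
    phiMax (rgram n x γ) T m ≤ phiMax (rgram n x γ) T k :=
  phiMax_le _ _ _ _ _ _ (phiMax_nonneg _ _ _ _ _) fun d hd =>
    phiMax_bound _ _ _ _ _ _ (hd.trans hmk)

lemma phiMax_add (n : ℕ) {p : ℕ} (x : Fin n → Fin p → ℝ) (γ : Fin p → ℝ)
    (T : Finset (Fin p)) (a b : ℕ) :
    phiMax (rgram n x γ) T (a + b) ≤ phiMax (rgram n x γ) T a + phiMax (rgram n x γ) T b := by
  have hPa := phiMax_nonneg n x γ T a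
  have hPb := phiMax_nonneg n x γ T b
  apply phiMax_le _ _ _ _ _ _ (add_nonneg hPa hPb)
  intro d hd
  obtain ⟨A, hA, hAcard⟩ := Finset.exists_subset_card_eq
    (Nat.min_le_right b (supp d \ T).card)
  have h1 : (supp (restr Aᶜ d) \ T).card ≤ a := by
    have hsub : supp (restr Aᶜ d) \ T ⊆ (supp d \ T) \ A := by
      intro j hj
      simp only [supp, restr, Finset.mem_sdiff, Finset.mem_filter, Finset.mem_univ, true_and,
        Finset.mem_compl, ne_eq, ite_eq_right_iff, not_forall] at hj ⊢
      tauto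
    have := Finset.card_le_card hsub
    rw [Finset.card_sdiff_of_subset hA, hAcard] at this
    omega
  have h2 : (supp (restr A d) \ T).card ≤ b := by
    have hsub : supp (restr A d) \ T ⊆ A := by
      intro j hj
      simp only [supp, restr, Finset.mem_sdiff, Finset.mem_filter, Finset.mem_univ, true_and,
        ne_eq, ite_eq_right_iff, not_forall] at hj
      exact hj.1.1
    have := Finset.card_le_card hsub
    omega
  have hQ1 := phiMax_bound n x γ T a _ h1
  have hQ2 := phiMax_bound n x γ T b _ h2
  have hN : ∑ j, d j ^ 2 = ∑ j, restr Aᶜ d j ^ 2 + ∑ j, restr A d j ^ 2 := by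
    rw [← Finset.sum_add_distrib]
    refine Finset.sum_congr rfl fun j _ => ?_
    by_cases h : j ∈ A <;> simp [restr, h]
  have hN1 : 0 ≤ ∑ j, restr Aᶜ d j ^ 2 := Finset.sum_nonneg fun _ _ => sq_nonneg _
  have hN2 : 0 ≤ ∑ j, restr A d j ^ 2 := Finset.sum_nonneg fun _ _ => sq_nonneg _
  have hq1 := quadForm_nonneg n x γ (restr Aᶜ d)
  have hq2 := quadForm_nonneg n x γ (restr A d)
  have hC := En_cs n (fun i => dot (x i) (fun j => restr Aᶜ d j / γ j))
    (fun i => dot (x i) (fun j => restr A d j / γ j))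
  have hexp : quadForm (rgram n x γ) d = quadForm (rgram n x γ) (restr Aᶜ d) +
      2 * (En n fun i => dot (x i) (fun j => restr Aᶜ d j / γ j) *
        dot (x i) (fun j => restr A d j / γ j)) + quadForm (rgram n x γ) (restr A d) := by
    rw [quadForm_rgram, quadForm_rgram, quadForm_rgram, ← En_smul, ← En_add, ← En_add]
    congr 1; funext i
    have : (fun j => d j / γ j) = (fun j => restr Aᶜ d j / γ j) + (fun j => restr A d j / γ j) := by
      funext j
      by_cases h : j ∈ A <;> simp [restr, h]
    rw [this, dot_add]; ring
  rw [← quadForm_rgram, ← quadForm_rgram] at hC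
  rw [hexp, hN]
  set C := En n fun i => dot (x i) (fun j => restr Aᶜ d j / γ j) *
        dot (x i) (fun j => restr A d j / γ j)
  set q1 := quadForm (rgram n x γ) (restr Aᶜ d)
  set q2 := quadForm (rgram n x γ) (restr A d)
  set P := phiMax (rgram n x γ) T a
  set R := phiMax (rgram n x γ) T b
  set N1 := ∑ j, restr Aᶜ d j ^ 2
  set N2 := ∑ j, restr A d j ^ 2
  have h3 : q1 * q2 ≤ (P * N1) * (R * N2) := mul_le_mul hQ1 hQ2 hq2 (by positivity)
  have h4 : (2 * C) ^ 2 ≤ (P * N2 + R * N1) ^ 2 := by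
    nlinarith [sq_nonneg (P * N2 - R * N1)]
  have h5 := abs_le_of_sq_le_sq' h4 (by positivity)
  nlinarith [h5.2]

lemma phiMax_mul (n : ℕ) {p : ℕ} (x : Fin n → Fin p → ℝ) (γ : Fin p → ℝ)
    (T : Finset (Fin p)) (m k : ℕ) :
    phiMax (rgram n x γ) T ((k + 1) * m) ≤ ((k + 1 : ℕ) : ℝ) * phiMax (rgram n x γ) T m := by
  induction k with
  | zero => simp
  | succ k ih =>
    have := phiMax_add n x γ T ((k + 1) * m) m
    rw [← Nat.succ_mul] at this
    refine this.trans ?_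
    push_cast at ih ⊢
    linarith

/-- the sparsity step -/
lemma sparsity (n : ℕ) {p : ℕ} (x : Fin n → Fin p → ℝ) (γ : Fin p → ℝ) (hγ : ∀ j, 1 ≤ γ j)
    (T S : Finset (Fin p)) (d : Fin p → ℝ) (a : ℝ) (ha : 0 ≤ a)
    (h : ∀ j ∈ S, a * γ j ≤ |En n fun i => x i j * dot (x i) d|) :
    (S.card : ℝ) * a ^ 2 ≤ phiMax (rgram n x γ) T (S \ T).card * predNorm n x d ^ 2 := by
  set w : Fin p → ℝ := restr S (fun j => (En n fun i => x i j * dot (x i) d) / γ j) with hw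
  have hsupp : (supp w \ T).card ≤ (S \ T).card := by
    apply Finset.card_le_card
    apply Finset.sdiff_subset_sdiff _ (le_refl _)
    intro j hj
    simp only [supp, hw, restr, Finset.mem_filter, Finset.mem_univ, true_and,
        ne_eq, ite_eq_right_iff, not_forall] at hj
    exact hj.1
  have hphi := phiMax_bound n x γ T _ w hsupp
  have hphi0 := phiMax_nonneg n x γ T (S \ T).card
  have hlow : (S.card : ℝ) * a ^ 2 ≤ ∑ j, w j ^ 2 := by
    calc (S.card : ℝ) * a ^ 2 = ∑ j ∈ S, a ^ 2 := by simp
      _ ≤ ∑ j ∈ S, w j ^ 2 := by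
        refine Finset.sum_le_sum fun j hj => ?_
        have hg : 0 < γ j := by linarith [hγ j]
        rw [← sq_abs (w j)]
        apply pow_le_pow_left₀ ha
        simp only [hw, restr, hj, if_true]
        rw [abs_div, abs_of_pos hg, le_div_iff₀ hg]
        exact h j hj
      _ ≤ _ := Finset.sum_le_sum_of_subset_of_nonneg (Finset.subset_univ _)
        fun _ _ _ => sq_nonneg _
  have hEq : ∑ j, w j ^ 2 = En n fun i => dot (x i) (fun j => w j / γ j) * dot (x i) d := by
    have : (fun i => dot (x i) (fun j => w j / γ j) * dot (x i) d) =
        fun i => ∑ j, (w j / γ j) * (x i j * dot (x i) d) := by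
      funext i
      rw [dot, Finset.sum_mul]
      exact Finset.sum_congr rfl fun j _ => by ring
    rw [this, En_sum]
    refine Finset.sum_congr rfl fun j _ => ?_
    rw [En_smul]
    by_cases hj : j ∈ S
    · simp only [hw, restr, hj, if_true]; ring
    · simp [hw, restr, hj]
  have hC := En_cs n (fun i => dot (x i) (fun j => w j / γ j)) (fun i => dot (x i) d)
  rw [← quadForm_rgram, ← hEq, ← predNorm_sq] at hC
  refine hlow.trans ?_
  have hD := sq_nonneg (predNorm n x d)
  set N := ∑ j, w j ^ 2
  have hN : 0 ≤ N := Finset.sum_nonneg fun _ _ => sq_nonneg _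
  rcases hN.eq_or_lt with h0 | h0
  · rw [← h0]; positivity
  · refine le_of_mul_le_mul_left ?_ h0
    nlinarith [mul_le_mul_of_nonneg_right hphi hD]

set_option maxHeartbeats 4000000 in
/-- Theorem 6, sparsity bound for square-root lasso. -/
theorem statement_11 (n p : ℕ) (hn : 1 ≤ n) (hp : 1 ≤ p)
    (x : Fin n → Fin p → ℝ) (β₀ γ : Fin p → ℝ) (hγ : ∀ j, 1 ≤ γ j)
    (hs : 1 ≤ (supp β₀).card)
    (σ : ℝ) (hσ : 0 ≤ σ) (ε rr : Fin n → ℝ) (y : Fin n → ℝ)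
    (hy : ∀ i, y i = dot (x i) β₀ + σ * ε i + rr i)
    (hQ : 0 < En n fun i => (σ * ε i + rr i) ^ 2)
    (lam : ℝ) (hlam : 0 < lam)
    (c : ℝ) (hc : 1 < c)
    (hdom : c * scoreSup n x ε rr σ γ ≤ lam / n)
    (βh : Fin p → ℝ)
    (hmin : ∀ β : Fin p → ℝ,
      Real.sqrt (Qhat n x y βh) + lam / n * l1 (scl γ βh) ≤
        Real.sqrt (Qhat n x y β) + lam / n * l1 (scl γ β))
    (hκ : 0 < kappaTilde n x γ (supp β₀))
    (ρ : ℝ)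
    (hρdef : ρ = lam * Real.sqrt (supp β₀).card / (n * kappaTilde n x γ (supp β₀)))
    (hρ : ρ < 1 / Real.sqrt 2)
    (hside : 2 * varrho n x γ (supp β₀) β₀ (score n x ε rr σ) ((c + 1) / (c - 1)) *
        (varrho n x γ (supp β₀) β₀ (score n x ε rr σ) ((c + 1) / (c - 1)) + ρ) /
          (1 - ρ ^ 2) ≤ 1 / ((c + 1) / (c - 1))) :
    ((supp βh).card : ℝ) ≤
        4 * ((c + 1) / (c - 1)) ^ 2 *
          (n / lam *
            ((varrho n x γ (supp β₀) β₀ (score n x ε rr σ) ((c + 1) / (c - 1)) + ρ) /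
              (1 - ρ ^ 2))) ^ 2 *
          phiMax (rgram n x γ) (supp β₀) ((supp βh \ supp β₀).card) ∧
      (0 < kappa n x γ (supp β₀) ((c + 1) / (c - 1)) →
        ∀ M : Set ℕ,
          M = {m : ℕ | ((supp β₀).card : ℝ) * phiMax (rgram n x γ) (supp β₀) m *
              (2 * (4 * ((c + 1) / (c - 1)) ^ 2 /
                  kappa n x γ (supp β₀) ((c + 1) / (c - 1))) ^ 2) < m} →
          M.Nonempty →
          ((supp βh \ supp β₀).card : ℝ) ≤
            ((supp β₀).card : ℝ) *
              (4 * ((c + 1) / (c - 1)) ^ 2 /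
                kappa n x γ (supp β₀) ((c + 1) / (c - 1))) ^ 2 *
              sInf {r | ∃ m ∈ M, r = phiMax (rgram n x γ) (supp β₀) m}) := by
  have hn0 : (0:ℝ) < n := by exact_mod_cast hn
  have hell : 0 < lam / n := div_pos hlam hn0
  have hc1 : 0 < c - 1 := by linarith
  have hvn := varrho_nonneg n x γ β₀ (score n x ε rr σ) (supp β₀) ((c + 1) / (c - 1))
  have hvb := varrho_bound n x ε rr σ hQ γ β₀ (supp β₀) ((c + 1) / (c - 1))
  have hcbdef : ((c + 1) / (c - 1)) * (c - 1) = c + 1 := div_mul_cancel₀ _ hc1.ne'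
  have hcb1 : 1 ≤ (c + 1) / (c - 1) := by rw [le_div_iff₀ hc1]; linarith
  have hcbinv : 1 / ((c + 1) / (c - 1)) = 1 - 2 / (c + 1) := by
    field_simp; ring
  set cb := (c + 1) / (c - 1) with hcb
  set ell := lam / n with hellD
  set T := supp β₀ with hT
  set v := varrho n x γ T β₀ (score n x ε rr σ) cb with hv
  have hs0 : 0 < Real.sqrt T.card := Real.sqrt_pos.2 (by exact_mod_cast hs)
  have hρell : ρ = ell * (Real.sqrt T.card / kappaTilde n x γ T) := by
    rw [hρdef, hellD, div_mul_div_comm]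
  have hρ0 : 0 < ρ := by rw [hρell]; positivity
  have hρsq : ρ ^ 2 < 1 / 2 := by
    have := pow_lt_pow_left₀ hρ hρ0.le two_ne_zero
    rwa [div_pow, one_pow, Real.sq_sqrt (by norm_num)] at this
  -- basic quantities
  set d : Fin p → ℝ := βh - β₀ with hd
  set D := predNorm n x d with hD
  have hD0 : 0 ≤ D := Real.sqrt_nonneg _
  set q0 := Real.sqrt (En n fun i => (σ * ε i + rr i) ^ 2) with hq0
  have hq0p : 0 < q0 := Real.sqrt_pos.2 hQ
  have hq0sq : q0 ^ 2 = En n fun i => (σ * ε i + rr i) ^ 2 := Real.sq_sqrt hQ.le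
  set q := Real.sqrt (Qhat n x y βh) with hq
  have hqn : 0 ≤ q := Real.sqrt_nonneg _
  have hqsq : q ^ 2 = Qhat n x y βh := Real.sq_sqrt (En_nonneg _ _ fun _ => sq_nonneg _)
  have hres : ∀ i, y i - dot (x i) βh = (σ * ε i + rr i) - dot (x i) d := by
    intro i; rw [hy i, hd, dot_sub]; ring
  have hQ0 : Real.sqrt (Qhat n x y β₀) = q0 := by
    rw [hq0, Qhat]; congr 2; funext i; rw [hy i]; ring
  set Sd := dot (score n x ε rr σ) d with hSd
  have hSd' : q0 * Sd = En n fun i => (σ * ε i + rr i) * dot (x i) d := by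
    rw [hSd, dot_score, ← hq0]; exact mul_div_cancel₀ _ hq0p.ne'
  have hqexp : q ^ 2 = q0 ^ 2 - 2 * (q0 * Sd) + D ^ 2 := by
    rw [hqsq, hq0sq, hSd', hD, predNorm_sq, sub_eq_add_neg, ← neg_mul, ← En_smul, ← En_add,
      ← En_add, Qhat]
    congr 1; funext i; rw [hres i]; ring
  -- convexity
  have hScs := score_cs n x ε rr σ hQ d
  rw [← hSd, ← hD] at hScs
  have hconv : q0 - Sd ≤ q := by
    have h1 : (q0 - Sd) ^ 2 ≤ q ^ 2 := by
      have : Sd ^ 2 ≤ D ^ 2 := by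
        rw [← sq_abs Sd]; exact pow_le_pow_left₀ (abs_nonneg _) hScs 2
      nlinarith
    exact (abs_le_of_sq_le_sq' h1 hqn).2
  have hmin0 := hmin β₀
  rw [hQ0] at hmin0
  have hldiff := l1_diff γ βh β₀
  rw [← hd, ← hT] at hldiff
  have hsplit := l1_split γ d T
  have hdual := score_l1 n x ε rr σ γ hγ d
  rw [← hSd] at hdual
  have hLd := l1_nonneg (scl γ d)
  have hdual2 : c * |Sd| ≤ ell * l1 (scl γ d) := by
    calc c * |Sd| ≤ c * (scoreSup n x ε rr σ γ * l1 (scl γ d)) :=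
          mul_le_mul_of_nonneg_left hdual (by linarith)
      _ = (c * scoreSup n x ε rr σ γ) * l1 (scl γ d) := by ring
      _ ≤ _ := mul_le_mul_of_nonneg_right hdom hLd
  have hLc : c * (l1 (scl γ βh) - l1 (scl γ β₀)) ≤ l1 (scl γ d) := by
    have h1 : ell * (l1 (scl γ βh) - l1 (scl γ β₀)) ≤ |Sd| := by
      have := le_abs_self Sd
      linarith
    have h2 := mul_le_mul_of_nonneg_left h1 (by linarith : (0:ℝ) ≤ c)
    refine le_of_mul_le_mul_left ?_ hell
    linarith
  have hsum : l1 (scl γ d) ≤ l1 (scl γ βh) + l1 (scl γ β₀) := by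
    have h1 := l1_add_le γ βh (-β₀)
    have h2 : l1 (scl γ (-β₀)) = l1 (scl γ β₀) := by simp [l1, scl]
    rw [h2, ← sub_eq_add_neg] at h1
    exact h1
  have hcone : l1 (scl γ (restr Tᶜ d)) ≤ cb * l1 (scl γ (restr T d)) := by
    rw [hcb, div_mul_eq_mul_div, le_div_iff₀ hc1]
    have := mul_le_mul_of_nonneg_left hldiff (by linarith : (0:ℝ) ≤ c)
    linarith
  have hball : l1 (scl γ (d + β₀)) ≤ cb * l1 (scl γ β₀) := by
    rw [hd, sub_add_cancel, hcb, div_mul_eq_mul_div, le_div_iff₀ hc1]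
    linarith
  have hSv : |Sd| ≤ v * D := hvb d hcone hball
  have hSv' : Sd ≤ v * D := (le_abs_self _).trans hSv
  have hkt := kappaTilde_bound n x γ T hκ d
  have hlρ : ell * (l1 (scl γ β₀) - l1 (scl γ βh)) ≤ ρ * D := by
    rw [hρell, mul_assoc]
    exact mul_le_mul_of_nonneg_left (by linarith) hell.le
  have hqup : q ≤ q0 + ρ * D := by linarith
  -- KKT in direction d
  have hk := kkt n x y γ βh ell hell.le hmin
  have hkd : D ^ 2 - q0 * Sd ≤ q * (ρ * D) := by
    have h1 := hk d
    have h2 : βh - d = β₀ := by rw [hd]; abel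
    have h3 : (En n fun i => (y i - dot (x i) βh) * dot (x i) d) = q0 * Sd - D ^ 2 := by
      rw [hSd', hD, predNorm_sq, sub_eq_add_neg, ← neg_one_mul, ← En_smul, ← En_add]
      congr 1; funext i; rw [hres i]; ring
    rw [h2, h3, ← hq] at h1
    have h4 := mul_le_mul_of_nonneg_left hlρ hqn
    linarith
  set B := (v + ρ) / (1 - ρ ^ 2) with hB
  have h1ρ : 0 < 1 - ρ ^ 2 := by linarith
  have hB0 : 0 < B := div_pos (by linarith) h1ρ
  have hBmul : B * (1 - ρ ^ 2) = v + ρ := div_mul_cancel₀ _ h1ρ.ne'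
  have hDB : D ≤ q0 * B := by
    rcases hD0.eq_or_lt with h0 | h0
    · rw [← h0]; positivity
    · have h1 : D * D ≤ D * (q0 * v + (q0 + ρ * D) * ρ) := by
        have h2 := mul_le_mul_of_nonneg_left hSv' hq0p.le
        have h3 := mul_le_mul_of_nonneg_right hqup (by positivity : 0 ≤ ρ * D)
        nlinarith
      have h2 := le_of_mul_le_mul_left h1 h0
      refine le_of_mul_le_mul_right ?_ h1ρ
      rw [mul_assoc, hBmul]
      linarith
  have hside' : 2 * v * B ≤ 1 - 2 / (c + 1) := by
    rw [← hcbinv, hB, ← mul_div_assoc]; exact hside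
  have hqlow : q0 * (1 / 2 + 1 / (c + 1)) ≤ q := by
    have h1 := mul_le_mul_of_nonneg_left hDB hvn
    have h2 := mul_le_mul_of_nonneg_left hside' hq0p.le
    have h3 : 2 / (c + 1) = 2 * (1 / (c + 1)) := by ring
    rw [h3] at h2
    nlinarith
  have hgap : q0 * (1 / (2 * cb)) ≤ q - q0 / c := by
    have h1 : 1 / (2 * cb) = 1 / 2 * (1 - 2 / (c + 1)) := by rw [← hcbinv]; field_simp
    have h2 : 1 / (2 * cb) + 1 / c ≤ 1 / 2 + 1 / (c + 1) := by
      rw [h1]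
      have : 1 / 2 + 1 / (c + 1) - (1 / 2 * (1 - 2 / (c + 1)) + 1 / c) =
        (c - 1) / (c * (c + 1)) := by field_simp; ring
      have h3 : 0 ≤ (c - 1) / (c * (c + 1)) := by positivity
      linarith
    have h3 := mul_le_mul_of_nonneg_left h2 hq0p.le
    have h4 : q0 / c = q0 * (1 / c) := by ring
    rw [h4]; linarith
  have hcb0 : 0 < cb := by linarith
  have hj : ∀ j ∈ supp βh, ell * (q0 * (1 / (2 * cb))) * γ j ≤
      |En n fun i => x i j * dot (x i) d| := by
    intro j hj
    have hbj : βh j ≠ 0 := by simpa [supp] using hj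
    have hg : 0 < γ j := by linarith [hγ j]
    have h1 := hk (Pi.single j (βh j))
    have h2 : l1 (scl γ βh) - l1 (scl γ (βh - Pi.single j (βh j))) = γ j * |βh j| := by
      simp only [l1, scl, ← Finset.sum_sub_distrib]
      rw [Finset.sum_eq_single j]
      · simp [abs_mul, abs_of_pos hg]
      · intro k _ hkj
        simp [hkj]
      · simp
    have h3 : ∀ i, dot (x i) (Pi.single j (βh j)) = x i j * βh j := by
      intro i; simp [dot, Pi.single_apply]
    have h4 : (En n fun i => (y i - dot (x i) βh) * dot (x i) (Pi.single j (βh j))) =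
        βh j * (q0 * score n x ε rr σ j - En n fun i => x i j * dot (x i) d) := by
      have h5 : q0 * score n x ε rr σ j = En n fun i => x i j * (σ * ε i + rr i) := by
        rw [score, ← hq0]; exact mul_div_cancel₀ _ hq0p.ne'
      rw [h5, sub_eq_add_neg, ← neg_one_mul, ← En_smul, ← En_add, ← En_smul]
      congr 1; funext i; rw [hres i, h3 i]; ring
    rw [h2, h4, ← hq] at h1
    set g := En n fun i => x i j * dot (x i) d
    have h6 : q * ell * γ j ≤ |q0 * score n x ε rr σ j - g| := by
      refine le_of_mul_le_mul_left ?_ (abs_pos.2 hbj)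
      rw [← abs_mul]
      refine le_trans ?_ (h1.trans (le_abs_self _))
      apply le_of_eq; ring
    have h7 : |q0 * score n x ε rr σ j - g| ≤ q0 * |score n x ε rr σ j| + |g| := by
      refine (abs_sub _ _).trans ?_
      rw [abs_mul, abs_of_pos hq0p]
    have h8 := score_dual n x ε rr σ γ hγ j
    have h9 : scoreSup n x ε rr σ γ ≤ ell / c := by
      rw [le_div_iff₀ (by linarith)]; linarith
    have h10 : |score n x ε rr σ j| ≤ ell / c * γ j :=
      h8.trans (mul_le_mul_of_nonneg_right h9 hg.le)
    have h11 := mul_le_mul_of_nonneg_left h10 hq0p.le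
    have h12 := mul_le_mul_of_nonneg_left hgap (by positivity : 0 ≤ ell * γ j)
    have h13 : ell * γ j * (q - q0 / c) = q * ell * γ j - q0 * (ell / c * γ j) := by ring
    rw [h13] at h12
    linarith
  have hsp := sparsity n x γ hγ T (supp βh) d _ (by positivity) hj
  rw [← hD] at hsp
  set φ := phiMax (rgram n x γ) T with hφ
  have hφ0 : ∀ m, 0 ≤ φ m := phiMax_nonneg n x γ T
  have part1 : ((supp βh).card : ℝ) ≤ 4 * cb ^ 2 * (n / lam * B) ^ 2 *
      φ ((supp βh \ T).card) := by
    have hD2 : D ^ 2 ≤ (q0 * B) ^ 2 := pow_le_pow_left₀ hD0 hDB 2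
    have h1 := hsp.trans (mul_le_mul_of_nonneg_left hD2 (hφ0 _))
    have hpos : 0 < (ell * (q0 * (1 / (2 * cb)))) ^ 2 := by positivity
    rw [← le_div_iff₀ hpos] at h1
    refine h1.trans (le_of_eq ?_)
    rw [hellD]
    field_simp
    ring
  refine ⟨part1, ?_⟩
  intro hκc M hM hMne
  set κ := kappa n x γ T cb with hκdef
  have hρκ : ρ ≤ ell * (Real.sqrt T.card / κ) := by
    rw [hρell]
    apply mul_le_mul_of_nonneg_left _ hell.le
    exact div_le_div_of_nonneg_left hs0.le hκc (kappa_le_tilde n x γ T cb hcb1 hκ)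
  have hvκ : v ≤ ell / c * ((1 + cb) * (Real.sqrt T.card / κ)) := by
    apply Real.sSup_le _ (by positivity)
    rintro r ⟨e, he, hep, -, rfl⟩
    rw [div_le_iff₀ hep]
    have h1 := score_l1 n x ε rr σ γ hγ e
    have h9 : scoreSup n x ε rr σ γ ≤ ell / c := by
      rw [le_div_iff₀ (by linarith)]; linarith
    have h2 := mul_le_mul_of_nonneg_right h9 (l1_nonneg (scl γ e))
    refine (h1.trans h2).trans ?_
    rw [mul_assoc]
    apply mul_le_mul_of_nonneg_left _ (by positivity)
    have h3 := kappa_bound n x γ T cb hκc e he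
    rw [l1_split γ e T, mul_assoc]
    have h4 := mul_le_mul_of_nonneg_left h3 (by linarith : (0:ℝ) ≤ 1 + cb)
    have h5 := he.2
    linarith
  have hBκ : B ≤ 2 * cb * (ell * (Real.sqrt T.card / κ)) := by
    rw [hB, div_le_iff₀ h1ρ]
    have h1 : v + ρ ≤ cb * (ell * (Real.sqrt T.card / κ)) := by
      have h2 : ell / c * ((1 + cb) * (Real.sqrt T.card / κ)) + ell * (Real.sqrt T.card / κ)
        = cb * (ell * (Real.sqrt T.card / κ)) := by
        have : (1 + cb) / c + 1 = cb := by rw [hcb]; field_simp; ring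
        calc _ = ((1 + cb) / c + 1) * (ell * (Real.sqrt T.card / κ)) := by ring
          _ = _ := by rw [this]
      linarith
    have h3 : 0 ≤ cb * (ell * (Real.sqrt T.card / κ)) := by positivity
    nlinarith
  have hT0 : (0:ℝ) < T.card := by exact_mod_cast hs
  set K := (4 * cb ^ 2 / κ) ^ 2 with hK
  have hK0 : 0 < K := by positivity
  have hmT : ((supp βh \ T).card : ℝ) ≤ (supp βh).card := by
    exact_mod_cast Finset.card_le_card Finset.sdiff_subset
  have hmain : ((supp βh \ T).card : ℝ) ≤ T.card * K * φ ((supp βh \ T).card) := by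
    refine hmT.trans (part1.trans (mul_le_mul_of_nonneg_right ?_ (hφ0 _)))
    have h1 : n / lam * B ≤ 2 * cb * (Real.sqrt T.card / κ) := by
      have h2 := mul_le_mul_of_nonneg_left hBκ (by positivity : 0 ≤ n / lam)
      refine h2.trans (le_of_eq ?_)
      rw [hellD]; field_simp
    have h3 := pow_le_pow_left₀ (by positivity) h1 2
    have h4 := mul_le_mul_of_nonneg_left h3 (by positivity : 0 ≤ 4 * cb ^ 2)
    refine h4.trans (le_of_eq ?_)
    have h5 : Real.sqrt T.card ^ 2 = T.card := Real.sq_sqrt hT0.le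
    rw [hK]
    calc 4 * cb ^ 2 * (2 * cb * (Real.sqrt T.card / κ)) ^ 2
        = Real.sqrt T.card ^ 2 * (4 * cb ^ 2 / κ) ^ 2 := by ring
      _ = _ := by rw [h5]
  set mh := (supp βh \ T).card with hmh
  have hTK : 0 < T.card * K := by positivity
  have hall : ∀ m ∈ M, (mh : ℝ) ≤ T.card * K * φ m := by
    intro m hm
    rw [hM] at hm
    have hm' : (T.card : ℝ) * φ m * (2 * K) < m := hm
    have hmpos : (0:ℝ) < m := lt_of_le_of_lt
      (mul_nonneg (mul_nonneg hT0.le (hφ0 m)) (by positivity)) hm'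
    have hle : mh ≤ m := by
      by_contra hlt
      push Not at hlt
      have hm0 : 0 < m := by exact_mod_cast hmpos
      have h1 : φ mh ≤ φ ((mh / m + 1) * m) := phiMax_mono n x γ T (by
        have := Nat.lt_div_mul_add (a := mh) hm0
        rw [Nat.succ_mul]; omega)
      have h2 : φ ((mh / m + 1) * m) ≤ ((mh / m + 1 : ℕ) : ℝ) * φ m := phiMax_mul n x γ T m _
      have h3 : ((mh / m + 1 : ℕ) : ℝ) * m ≤ 2 * mh := by
        have h4 : (mh / m + 1) * m ≤ 2 * mh := by
          have := Nat.div_mul_le_self mh m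
          rw [Nat.succ_mul]; omega
        exact_mod_cast h4
      have hk0 : (0:ℝ) < ((mh / m + 1 : ℕ) : ℝ) := by exact_mod_cast Nat.succ_pos _
      generalize ((mh / m + 1 : ℕ) : ℝ) = k at h2 h3 hk0
      have h5 := mul_le_mul_of_nonneg_left (h1.trans h2) hTK.le
      have h6 := mul_lt_mul_of_pos_left hm' hk0
      have h7 : k * (T.card * φ m * (2 * K)) = 2 * (T.card * K * (k * φ m)) := by ring
      linarith
    exact hmain.trans (mul_le_mul_of_nonneg_left (phiMax_mono n x γ T hle) hTK.le)
  have hfin : (mh : ℝ) / (T.card * K) ≤ sInf {r | ∃ m ∈ M, r = φ m} := by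
    obtain ⟨m0, hm0⟩ := hMne
    refine le_csInf (s := {r | ∃ m ∈ M, r = φ m}) ⟨φ m0, m0, hm0, rfl⟩ ?_
    rintro r ⟨m, hm, rfl⟩
    rw [div_le_iff₀ hTK, mul_comm]
    exact hall m hm
  rw [div_le_iff₀ hTK, mul_comm] at hfin
  exact hfin
end SqrtLasso
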